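/- arXiv:1409.8186 — 2 statements merged into one kernel-verified Lean document; each statement's English description precedes it below -/
import Mathlib

section
/- Graf's addition theorem: if b, r are two vectors in ℝ² with ‖r‖ < ‖b‖, and α, θ denote respectively the polar angles of b and r, then H_0^{(1)}(k‖b + r‖) = Σ_{m∈ℤ} H_m^{(1)}(k‖b‖) J_m(k‖r‖) e^{i m (θ − α ± π)} appropriately signed, i.e. H_0^{(1)}(k‖b − r‖) = Σ_{m∈ℤ} H_m^{(1)}(k‖b‖) J_m(k‖r‖) e^{im(θ−α)}, with absolute convergence of the series. -/
open Complex Real MeasureTheory Filter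

noncomputable def polarAngle (x : ℝ × ℝ) : ℝ := Complex.arg (x.1 + x.2 * Complex.I)

noncomputable def norm2 (x : ℝ × ℝ) : ℝ := Real.sqrt (x.1 ^ 2 + x.2 ^ 2)

noncomputable def circlePt (O : ℝ × ℝ) (a t : ℝ) : ℝ × ℝ :=
  (O.1 + a * Real.cos t, O.2 + a * Real.sin t)

noncomputable def phiP (O : ℝ × ℝ) (a : ℝ) (m : ℤ) (x : ℝ × ℝ) : ℂ :=
  Complex.exp (Complex.I * (m : ℂ) * ((polarAngle (x - O) : ℝ) : ℂ)) /
    ((Real.sqrt (2 * Real.pi * a) : ℝ) : ℂ)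

/-- Bessel function of the first kind of integer order `m` (real argument). -/
noncomputable def besselJ (m : ℤ) (z : ℝ) : ℝ :=
  (1 / Real.pi) * ∫ t in (0:ℝ)..Real.pi, Real.cos (z * Real.sin t - (m : ℝ) * t)

/-- Bessel function of the second kind of integer order `m` (for `z > 0`). -/
noncomputable def besselY (m : ℤ) (z : ℝ) : ℝ :=
  (1 / Real.pi) * (∫ t in (0:ℝ)..Real.pi, Real.sin (z * Real.sin t - (m : ℝ) * t))
    - (1 / Real.pi) * ∫ t in Set.Ioi (0:ℝ),
        (Real.exp ((m : ℝ) * t) + (-1 : ℝ) ^ m * Real.exp (-(m : ℝ) * t)) *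
          Real.exp (-z * Real.sinh t)

/-- Hankel function of the first kind of integer order `m`. -/
noncomputable def hankelH1 (m : ℤ) (z : ℝ) : ℂ :=
  (besselJ m z : ℂ) + Complex.I * (besselY m z : ℂ)

/-- 2D Helmholtz Green's function with wavenumber `k`. -/
noncomputable def G (k : ℝ) (x y : ℝ × ℝ) : ℂ :=
  (Complex.I / 4) * hankelH1 0 (k * norm2 (x - y))

/-- Laplacian of `f : ℝ² → ℂ` computed coordinatewise. -/
noncomputable def lap (f : ℝ × ℝ → ℂ) (x : ℝ × ℝ) : ℂ :=
  deriv (deriv (fun s => f (s, x.2))) x.1 + deriv (deriv (fun s => f (x.1, s))) x.2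


/-- Coefficient of `u ^ p.1 * v ^ p.2` in `exp (x / 2 * (u - v))`. -/
noncomputable def besselCoeff (x : ℝ) (p : ℕ × ℕ) : ℝ :=
  (x / 2) ^ p.1 / (p.1.factorial : ℝ) * ((-(x / 2)) ^ p.2 / (p.2.factorial : ℝ))

/-- The exponent of `w` in the monomial `w ^ p.1 * (w⁻¹) ^ p.2`. -/
def besselDegree (p : ℕ × ℕ) : ℤ := (p.1 : ℤ) - (p.2 : ℤ)

lemma hasSum_pow_div_factorial_mul {𝕜 : Type*} [RCLike 𝕜] (a b : 𝕜) :
    HasSum (fun p : ℕ × ℕ => a ^ p.1 / (p.1.factorial : 𝕜) * (b ^ p.2 / (p.2.factorial : 𝕜)))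
      (NormedSpace.exp (a + b)) := by
  have hs := summable_mul_of_summable_norm (NormedSpace.norm_expSeries_div_summable a)
    (NormedSpace.norm_expSeries_div_summable b)
  have h := (NormedSpace.expSeries_div_hasSum_exp a).mul
    (NormedSpace.expSeries_div_hasSum_exp b) hs
  rwa [← NormedSpace.exp_add] at h

lemma hasSum_besselCoeff_mul_zpow (x : ℝ) {w : ℂ} (hw : w ≠ 0) :
    HasSum (fun p => (besselCoeff x p : ℂ) * w ^ besselDegree p)
      (Complex.exp (x / 2 * (w - w⁻¹))) := by
  have h := hasSum_pow_div_factorial_mul ((x / 2 : ℂ) * w) (-(x / 2 : ℂ) * w⁻¹)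
  rw [← Complex.exp_eq_exp_ℂ, show (x / 2 : ℂ) * w + -(x / 2 : ℂ) * w⁻¹ = x / 2 * (w - w⁻¹) by
    ring] at h
  refine h.congr_fun fun p => ?_
  simp only [besselCoeff, besselDegree, zpow_sub₀ hw, zpow_natCast, mul_pow, inv_pow]
  push_cast
  ring

lemma hasSum_abs_besselCoeff_mul_zpow {x ρ : ℝ} (hx : 0 ≤ x) (hρ : 0 < ρ) :
    HasSum (fun p => |besselCoeff x p| * ρ ^ besselDegree p)
      (Real.exp (x / 2 * (ρ + ρ⁻¹))) := by
  have h := hasSum_pow_div_factorial_mul (x / 2 * ρ) (x / 2 * ρ⁻¹)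
  rw [← Real.exp_eq_exp_ℝ, ← mul_add] at h
  refine h.congr_fun fun p => ?_
  have hx2 : |x / 2| = x / 2 := abs_of_nonneg (by positivity)
  simp only [besselCoeff, besselDegree, zpow_sub₀ hρ.ne', zpow_natCast, mul_pow, inv_pow,
    abs_mul, abs_div, abs_pow, abs_neg, hx2, Nat.abs_cast]
  ring

lemma integral_cos_int_mul (n : ℤ) :
    ∫ t in (0 : ℝ)..Real.pi, Real.cos (n * t) = if n = 0 then Real.pi else 0 := by
  split_ifs with h
  · simp [h]
  · rw [intervalIntegral.integral_comp_mul_left _ (by exact_mod_cast h : (n : ℝ) ≠ 0)]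
    simp

lemma hasSum_besselJ (m : ℤ) {x : ℝ} (hx : 0 ≤ x) :
    HasSum (fun p => if besselDegree p = m then besselCoeff x p else 0) (besselJ m x) := by
  have hb := hasSum_abs_besselCoeff_mul_zpow hx one_pos
  have key : HasSum
      (fun p => ∫ t in (0 : ℝ)..Real.pi,
        besselCoeff x p * Real.cos (((besselDegree p - m : ℤ) : ℝ) * t))
      (∫ t in (0 : ℝ)..Real.pi, Real.cos (x * Real.sin t - (m : ℝ) * t)) := by
    refine intervalIntegral.hasSum_integral_of_dominated_convergence
      (fun p _ => |besselCoeff x p| * 1 ^ besselDegree p) ?_ ?_ ?_ ?_ ?_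
    · exact fun p => Continuous.aestronglyMeasurable (by fun_prop)
    · refine fun p => ae_of_all _ fun t _ => ?_
      rw [one_zpow, mul_one, Real.norm_eq_abs, abs_mul]
      exact mul_le_of_le_one_right (abs_nonneg _) (Real.abs_cos_le_one _)
    · exact ae_of_all _ fun t _ => hb.summable
    · exact intervalIntegrable_const
    · refine ae_of_all _ fun t _ => ?_
      have h := (hasSum_besselCoeff_mul_zpow x (Complex.exp_ne_zero (t * Complex.I))).mul_right
        (Complex.exp (-(m * t) * Complex.I))
      have hre := Complex.hasSum_re h
      rw [← Complex.exp_add, ← Complex.exp_neg,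
        show (x / 2 * (Complex.exp (t * Complex.I) - Complex.exp (-(t * Complex.I))) +
            -(m * t) * Complex.I : ℂ) = ((x * Real.sin t - m * t : ℝ) : ℂ) * Complex.I by
          push_cast
          rw [Complex.sin, ← neg_mul]
          linear_combination (-(x : ℂ) / 2 * (Complex.exp (-t * Complex.I) -
            Complex.exp (t * Complex.I))) * Complex.I_sq,
        Complex.exp_ofReal_mul_I_re] at hre
      refine hre.congr_fun fun p => ?_
      rw [← Complex.exp_int_mul, mul_assoc, ← Complex.exp_add, Complex.re_ofReal_mul,
        show (besselDegree p : ℂ) * (t * Complex.I) + -(m * t) * Complex.I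
          = (((besselDegree p - m : ℤ) : ℝ) * t : ℝ) * Complex.I by push_cast; ring,
        Complex.exp_ofReal_mul_I_re]
  refine (key.mul_left (1 / Real.pi)).congr_fun fun p => ?_
  rw [intervalIntegral.integral_const_mul, integral_cos_int_mul]
  simp only [sub_eq_zero]
  split_ifs
  · field_simp
  · simp

lemma hankelH1_eq_integral (m : ℤ) (z : ℝ) :
    hankelH1 m z = 1 / Real.pi *
      ((∫ t in (0 : ℝ)..Real.pi,
          Complex.exp (Complex.I * (z * Real.sin t)) * Complex.exp (-Complex.I * t) ^ m) -
        Complex.I * ∫ t in Set.Ioi (0 : ℝ),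
          ((Real.exp t : ℂ) ^ m + (-(Real.exp (-t) : ℂ)) ^ m) * Real.exp (-z * Real.sinh t)) := by
  have h1 : (∫ t in (0 : ℝ)..Real.pi,
      Complex.exp (Complex.I * (z * Real.sin t)) * Complex.exp (-Complex.I * t) ^ m) =
      ((∫ t in (0 : ℝ)..Real.pi, Real.cos (z * Real.sin t - (m : ℝ) * t) : ℝ) : ℂ) +
      Complex.I * ((∫ t in (0 : ℝ)..Real.pi, Real.sin (z * Real.sin t - (m : ℝ) * t) : ℝ) : ℂ) := by
    rw [← intervalIntegral.integral_ofReal, ← intervalIntegral.integral_ofReal,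
      ← intervalIntegral.integral_const_mul, ← intervalIntegral.integral_add]
    · refine intervalIntegral.integral_congr fun t _ => ?_
      simp only [Complex.ofReal_cos, Complex.ofReal_sin]
      rw [← Complex.exp_int_mul, ← Complex.exp_add, mul_comm Complex.I (Complex.sin _),
        ← Complex.exp_mul_I]
      congr 1
      push_cast
      ring
    · exact Continuous.intervalIntegrable (by fun_prop) _ _
    · exact Continuous.intervalIntegrable (by fun_prop) _ _
  have h2 : (∫ t in Set.Ioi (0 : ℝ),
      ((Real.exp t : ℂ) ^ m + (-(Real.exp (-t) : ℂ)) ^ m) * Real.exp (-z * Real.sinh t)) =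
      ((∫ t in Set.Ioi (0:ℝ), (Real.exp ((m : ℝ) * t) + (-1 : ℝ) ^ m * Real.exp (-(m : ℝ) * t)) *
          Real.exp (-z * Real.sinh t) : ℝ) : ℂ) := by
    rw [← integral_complex_ofReal]
    refine integral_congr_ae (ae_of_all _ fun t => ?_)
    simp only []
    rw [neg_eq_neg_one_mul (Real.exp (-t) : ℂ), mul_zpow, show -(m : ℝ) * t = m * -t by ring]
    push_cast
    rw [Complex.exp_int_mul, Complex.exp_int_mul]
  rw [h1, h2, hankelH1, besselJ, besselY]
  push_cast
  ring

lemma integrableOn_exp_cosh_sub_sinh {x z : ℝ} (hx : 0 ≤ x) (hxz : x < z) :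
    IntegrableOn (fun t => Real.exp (x * Real.cosh t - z * Real.sinh t)) (Set.Ioi 0) := by
  refine Integrable.mono' ((exp_neg_integrableOn_Ioi 0 (sub_pos.2 hxz)).const_mul (Real.exp x))
    (Continuous.aestronglyMeasurable (by fun_prop))
    ((ae_restrict_iff' measurableSet_Ioi).2 (ae_of_all _ fun t (ht : 0 < t) => ?_))
  rw [Real.norm_eq_abs, Real.abs_exp, ← Real.exp_add, Real.exp_le_exp]
  have h1 : Real.cosh t - Real.sinh t ≤ 1 := by
    rw [Real.cosh_sub_sinh]
    exact Real.exp_le_one_iff.2 (by linarith)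
  have h2 := Real.self_le_sinh_iff.2 ht.le
  nlinarith [mul_le_mul_of_nonneg_left h1 hx, mul_le_mul_of_nonneg_left h2 (sub_pos.2 hxz).le]

lemma hasSum_besselCoeff_mul_hankelH1 {x z : ℝ} (hx : 0 ≤ x) (hxz : x < z) {w : ℂ}
    (hw : ‖w‖ = 1) :
    HasSum (fun p => (besselCoeff x p : ℂ) * w ^ besselDegree p * hankelH1 (besselDegree p) z)
      (1 / Real.pi * ((∫ t in (0 : ℝ)..Real.pi, Complex.exp (Complex.I * (z * Real.sin t)) *
          Complex.exp (x / 2 *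
            (w * Complex.exp (-Complex.I * t) - (w * Complex.exp (-Complex.I * t))⁻¹))) -
        Complex.I * ∫ t in Set.Ioi (0 : ℝ),
          (Complex.exp (x / 2 * (w * Real.exp t - (w * Real.exp t)⁻¹)) +
            Complex.exp (x / 2 * (w * -(Real.exp (-t)) - (w * -(Real.exp (-t)))⁻¹))) *
              Real.exp (-z * Real.sinh t))) := by
  have hw0 : w ≠ 0 := norm_ne_zero_iff.1 (by simp [hw])
  have hexp (t : ℝ) : (Real.exp t : ℂ) ≠ 0 := by exact_mod_cast (Real.exp_pos t).ne'
  have hfinite : HasSum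
      (fun p => ∫ t in (0 : ℝ)..Real.pi, (besselCoeff x p : ℂ) * w ^ besselDegree p *
        (Complex.exp (Complex.I * (z * Real.sin t)) *
          Complex.exp (-Complex.I * t) ^ besselDegree p))
      (∫ t in (0 : ℝ)..Real.pi, Complex.exp (Complex.I * (z * Real.sin t)) *
          Complex.exp (x / 2 *
            (w * Complex.exp (-Complex.I * t) - (w * Complex.exp (-Complex.I * t))⁻¹))) := by
    have hb := hasSum_abs_besselCoeff_mul_zpow hx one_pos
    refine intervalIntegral.hasSum_integral_of_dominated_convergence
      (fun p _ => |besselCoeff x p| * 1 ^ besselDegree p) ?_ ?_ ?_ ?_ ?_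
    · refine fun p => Continuous.aestronglyMeasurable ?_
      simp only [← Complex.exp_int_mul]
      fun_prop
    · refine fun p => ae_of_all _ fun t _ => le_of_eq ?_
      simp [hw, Complex.norm_exp]
    · exact ae_of_all _ fun t _ => hb.summable
    · exact intervalIntegrable_const
    · refine ae_of_all _ fun t _ => ?_
      refine ((hasSum_besselCoeff_mul_zpow x (mul_ne_zero hw0
        (Complex.exp_ne_zero (-Complex.I * t)))).mul_left _).congr_fun fun p => ?_
      rw [mul_zpow]
      ring
  have hinfinite : HasSum
      (fun p => ∫ t in Set.Ioi (0 : ℝ), (besselCoeff x p : ℂ) * w ^ besselDegree p *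
        (((Real.exp t : ℂ) ^ besselDegree p + (-(Real.exp (-t) : ℂ)) ^ besselDegree p) *
          Real.exp (-z * Real.sinh t)))
      (∫ t in Set.Ioi (0 : ℝ),
          (Complex.exp (x / 2 * (w * Real.exp t - (w * Real.exp t)⁻¹)) +
            Complex.exp (x / 2 * (w * -(Real.exp (-t)) - (w * -(Real.exp (-t)))⁻¹))) *
              Real.exp (-z * Real.sinh t)) := by
    have hb (t : ℝ) : HasSum (fun p => |besselCoeff x p| *
        (Real.exp t ^ besselDegree p + Real.exp (-t) ^ besselDegree p) *
          Real.exp (-z * Real.sinh t))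
        (2 * Real.exp (x * Real.cosh t - z * Real.sinh t)) := by
      have h := ((hasSum_abs_besselCoeff_mul_zpow hx (Real.exp_pos t)).add
        (hasSum_abs_besselCoeff_mul_zpow hx (Real.exp_pos (-t)))).mul_right
          (Real.exp (-z * Real.sinh t))
      have e : (Real.exp (x / 2 * (Real.exp t + (Real.exp t)⁻¹)) +
          Real.exp (x / 2 * (Real.exp (-t) + (Real.exp (-t))⁻¹))) * Real.exp (-z * Real.sinh t) =
          2 * Real.exp (x * Real.cosh t - z * Real.sinh t) := by
        rw [← Real.exp_neg, ← Real.exp_neg, neg_neg, add_comm (Real.exp (-t)), ← two_mul, mul_assoc,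
          ← Real.exp_add, Real.cosh_eq]
        congr 2
        ring
      rw [e] at h
      exact h.congr_fun fun p => by ring
    refine hasSum_integral_of_dominated_convergence (fun p t => |besselCoeff x p| *
        (Real.exp t ^ besselDegree p + Real.exp (-t) ^ besselDegree p) *
          Real.exp (-z * Real.sinh t)) ?_ ?_ ?_ ?_ ?_
    · intro p
      refine Continuous.aestronglyMeasurable ?_
      have h1 : Continuous fun t : ℝ => (Real.exp t : ℂ) ^ besselDegree p :=
        Continuous.zpow₀ (by fun_prop) _ fun t => Or.inl (hexp t)
      have h2 : Continuous fun t : ℝ => (-(Real.exp (-t) : ℂ)) ^ besselDegree p :=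
        Continuous.zpow₀ (by fun_prop) _ fun t => Or.inl (neg_ne_zero.2 (hexp _))
      fun_prop
    · refine fun p => ae_of_all _ fun t => ?_
      rw [norm_mul, norm_mul, norm_mul, norm_zpow, hw, one_zpow, mul_one, Complex.norm_real,
        Complex.norm_real, Real.norm_eq_abs, Real.norm_eq_abs, Real.abs_exp, ← mul_assoc]
      gcongr
      refine (norm_add_le _ _).trans_eq ?_
      rw [norm_zpow, norm_zpow, norm_neg, Complex.norm_real, Complex.norm_real,
        Real.norm_eq_abs, Real.norm_eq_abs, Real.abs_exp, Real.abs_exp]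
    · exact ae_of_all _ fun t => (hb t).summable
    · simp only [(hb _).tsum_eq]
      exact (integrableOn_exp_cosh_sub_sinh hx hxz).const_mul 2
    · refine ae_of_all _ fun t => ?_
      refine (((hasSum_besselCoeff_mul_zpow x (mul_ne_zero hw0 (hexp t))).add
        (hasSum_besselCoeff_mul_zpow x
          (mul_ne_zero hw0 (neg_ne_zero.2 (hexp (-t)))))).mul_right _).congr_fun fun p => ?_
      rw [mul_zpow, mul_zpow]
      ring
  refine ((hfinite.sub (hinfinite.mul_left Complex.I)).mul_left (1 / Real.pi : ℂ)).congr_fun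
    fun p => ?_
  rw [intervalIntegral.integral_const_mul, integral_const_mul, hankelH1_eq_integral]
  ring

/-- Integrand of the Sommerfeld contour integral for `hankelH1 0 R`. -/
noncomputable def sommerfeldKernel (R : ℝ) (u : ℂ) : ℂ :=
  Complex.exp (Complex.I * (R * Complex.sin u))

lemma differentiable_sommerfeldKernel (R : ℝ) : Differentiable ℂ (sommerfeldKernel R) := by
  unfold sommerfeldKernel
  fun_prop

lemma continuous_sommerfeldKernel (R : ℝ) : Continuous (sommerfeldKernel R) :=
  (differentiable_sommerfeldKernel R).continuous

lemma sommerfeldKernel_pi_sub (R : ℝ) (u : ℂ) :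
    sommerfeldKernel R (Real.pi - u) = sommerfeldKernel R u := by
  rw [sommerfeldKernel, Complex.sin_pi_sub, sommerfeldKernel]

lemma norm_sommerfeldKernel (R s y : ℝ) :
    ‖sommerfeldKernel R (s + y * Complex.I)‖ = Real.exp (-(R * Real.cos s) * Real.sinh y) := by
  have h : Complex.I * (R * Complex.sin (s + y * Complex.I)) =
      ((-(R * Real.cos s) * Real.sinh y : ℝ) : ℂ) +
        ((R * Real.sin s * Real.cosh y : ℝ) : ℂ) * Complex.I := by
    rw [Complex.sin_add_mul_I]
    push_cast
    linear_combination (R * Complex.cos s * Complex.sinh y) * Complex.I_sq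
  rw [sommerfeldKernel, Complex.norm_exp, h, Complex.add_re, Complex.ofReal_re,
    Complex.re_ofReal_mul, Complex.I_re, mul_zero, add_zero]

lemma integrableOn_sommerfeldKernel {R s : ℝ} (hR : 0 < R) (hs : |s| < Real.pi / 2) :
    IntegrableOn (fun y : ℝ => sommerfeldKernel R (s + y * Complex.I)) (Set.Ioi 0) := by
  have hc : 0 < R * Real.cos s := mul_pos hR (Real.cos_pos_of_mem_Ioo (abs_lt.1 hs))
  refine Integrable.mono' (exp_neg_integrableOn_Ioi 0 hc)
    (Continuous.aestronglyMeasurable ((continuous_sommerfeldKernel R).comp (by fun_prop)))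
    ((ae_restrict_iff' measurableSet_Ioi).2 (ae_of_all _ fun t (ht : 0 < t) => ?_))
  rw [norm_sommerfeldKernel, Real.exp_le_exp]
  nlinarith [Real.self_le_sinh_iff.2 ht.le]

lemma integral_sommerfeldKernel_sub {R s : ℝ} (hR : 0 < R) (hs : |s| < Real.pi / 2) :
    (∫ y in Set.Ioi (0 : ℝ), sommerfeldKernel R (s + y * Complex.I)) -
        ∫ y in Set.Ioi (0 : ℝ), sommerfeldKernel R (y * Complex.I) =
      Complex.I * ∫ t in (0 : ℝ)..s, sommerfeldKernel R t := by
  have hc : 0 < R * Real.cos s := mul_pos hR (Real.cos_pos_of_mem_Ioo (abs_lt.1 hs))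
  have hrect (T : ℝ) : (∫ t in (0 : ℝ)..s, sommerfeldKernel R t) -
      (∫ t in (0 : ℝ)..s, sommerfeldKernel R (t + T * Complex.I)) +
      Complex.I * (∫ y in (0 : ℝ)..T, sommerfeldKernel R (s + y * Complex.I)) -
      Complex.I * (∫ y in (0 : ℝ)..T, sommerfeldKernel R (y * Complex.I)) = 0 := by
    simpa using Complex.integral_boundary_rect_eq_zero_of_differentiableOn (sommerfeldKernel R)
      0 (s + T * Complex.I) (differentiable_sommerfeldKernel R).differentiableOn
  have htop : Tendsto (fun T : ℝ => ∫ t in (0 : ℝ)..s, sommerfeldKernel R (t + T * Complex.I))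
      atTop (nhds 0) := by
    have hlim : Tendsto (fun T : ℝ => Real.exp (-(R * Real.cos s) * T) * |s - 0|) atTop
        (nhds 0) := by
      have h1 : Tendsto (fun T : ℝ => -(R * Real.cos s) * T) atTop atBot :=
        tendsto_id.const_mul_atTop_of_neg (neg_neg_of_pos hc)
      simpa using (Real.tendsto_exp_atBot.comp h1).mul_const |s - 0|
    refine squeeze_zero_norm' ?_ hlim
    filter_upwards [eventually_ge_atTop 0] with T hT
    refine intervalIntegral.norm_integral_le_of_norm_le_const fun t ht => ?_
    rw [norm_sommerfeldKernel, Real.exp_le_exp]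
    have hts : |t| ≤ |s| := by
      rcases Set.mem_uIoc.1 ht with h | h
      · rw [abs_of_pos h.1]
        exact h.2.trans (le_abs_self s)
      · rw [abs_of_nonpos h.2]
        exact (neg_le_neg h.1.le).trans (neg_le_abs s)
    have hcos : Real.cos s ≤ Real.cos t := by
      rw [← Real.cos_abs s, ← Real.cos_abs t]
      exact Real.cos_le_cos_of_nonneg_of_le_pi (abs_nonneg t)
        (hs.le.trans (by linarith [Real.pi_pos])) hts
    have hsinh := Real.self_le_sinh_iff.2 hT
    have h2 : R * Real.cos s * T ≤ R * Real.cos t * Real.sinh T :=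
      mul_le_mul (by gcongr) hsinh hT (hc.le.trans (by gcongr))
    linarith
  have hint : Tendsto (fun T : ℝ => ∫ y in (0 : ℝ)..T, sommerfeldKernel R (s + y * Complex.I))
      atTop (nhds (∫ y in Set.Ioi (0 : ℝ), sommerfeldKernel R (s + y * Complex.I))) :=
    intervalIntegral_tendsto_integral_Ioi 0 (integrableOn_sommerfeldKernel hR hs) tendsto_id
  have hint0 : Tendsto (fun T : ℝ => ∫ y in (0 : ℝ)..T, sommerfeldKernel R (y * Complex.I))
      atTop (nhds (∫ y in Set.Ioi (0 : ℝ), sommerfeldKernel R (y * Complex.I))) := by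
    refine intervalIntegral_tendsto_integral_Ioi 0 ?_ tendsto_id
    simpa using integrableOn_sommerfeldKernel (s := 0) hR (by simpa using Real.pi_pos)
  have hlim := ((htop.const_sub (∫ t in (0 : ℝ)..s, sommerfeldKernel R t)).add
    (hint.const_mul Complex.I)).sub (hint0.const_mul Complex.I)
  simp only [hrect] at hlim
  have h0 := tendsto_nhds_unique tendsto_const_nhds hlim
  linear_combination Complex.I * h0 +
    ((∫ y in Set.Ioi (0 : ℝ), sommerfeldKernel R (s + y * Complex.I)) -
      ∫ y in Set.Ioi (0 : ℝ), sommerfeldKernel R (y * Complex.I)) * Complex.I_sq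

/-- Integral of the Sommerfeld kernel along the contour shifted horizontally by `s`. -/
noncomputable def sommerfeldIntegral (R s : ℝ) : ℂ :=
  (∫ t in (0 : ℝ)..Real.pi, sommerfeldKernel R ((t + s : ℝ) : ℂ)) -
    Complex.I * ∫ y in Set.Ioi (0 : ℝ),
      (sommerfeldKernel R (s + y * Complex.I) +
        sommerfeldKernel R (((-s : ℝ) : ℂ) + y * Complex.I))

lemma sommerfeldIntegral_eq {R s : ℝ} (hR : 0 < R) (hs : |s| < Real.pi / 2) :
    sommerfeldIntegral R s = sommerfeldIntegral R 0 := by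
  have hs' : |-s| < Real.pi / 2 := by rwa [abs_neg]
  have h0 : |(0 : ℝ)| < Real.pi / 2 := by simpa using Real.pi_pos
  have hi (a b : ℝ) : IntervalIntegrable (fun t : ℝ => sommerfeldKernel R t) volume a b :=
    ((continuous_sommerfeldKernel R).comp Complex.continuous_ofReal).intervalIntegrable _ _
  have hshift : (∫ t in (0 : ℝ)..Real.pi, sommerfeldKernel R ((t + s : ℝ) : ℂ)) =
      (∫ t in (0 : ℝ)..Real.pi, sommerfeldKernel R t) - (∫ t in (0 : ℝ)..s, sommerfeldKernel R t) +
        ∫ t in Real.pi..(Real.pi + s), sommerfeldKernel R t := by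
    rw [intervalIntegral.integral_comp_add_right (fun t : ℝ => sommerfeldKernel R t), zero_add]
    rw [← intervalIntegral.integral_add_adjacent_intervals (hi s 0) (hi 0 (Real.pi + s)),
      ← intervalIntegral.integral_add_adjacent_intervals (hi 0 Real.pi) (hi Real.pi (Real.pi + s)),
      intervalIntegral.integral_symm 0 s]
    ring
  have hreflect : (∫ t in Real.pi..(Real.pi + s), sommerfeldKernel R t) =
      -∫ t in (0 : ℝ)..-s, sommerfeldKernel R t := by
    have h := intervalIntegral.integral_comp_sub_left (fun t : ℝ => sommerfeldKernel R t) Real.pi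
      (a := 0) (b := -s)
    simp only [Complex.ofReal_sub, sommerfeldKernel_pi_sub, sub_zero, sub_neg_eq_add] at h
    rw [h, intervalIntegral.integral_symm]
  simp only [sommerfeldIntegral]
  rw [integral_add (integrableOn_sommerfeldKernel hR hs) (integrableOn_sommerfeldKernel hR hs'),
    integral_add (integrableOn_sommerfeldKernel hR h0)
      (integrableOn_sommerfeldKernel hR (by simpa using h0)),
    hshift, hreflect]
  have e1 := integral_sommerfeldKernel_sub hR hs
  have e2 := integral_sommerfeldKernel_sub hR hs'
  simp only [add_zero, neg_zero, Complex.ofReal_zero, zero_add] at *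
  linear_combination (-Complex.I) * e1 + (-Complex.I) * e2 -
    ((∫ t in (0 : ℝ)..s, sommerfeldKernel R t) + ∫ t in (0 : ℝ)..-s, sommerfeldKernel R t) *
      Complex.I_sq

lemma hankelH1_zero_eq (R : ℝ) : hankelH1 0 R = 1 / Real.pi * sommerfeldIntegral R 0 := by
  rw [hankelH1_eq_integral, sommerfeldIntegral]
  have h (y : ℝ) : sommerfeldKernel R (y * Complex.I) = (Real.exp (-R * Real.sinh y) : ℝ) := by
    rw [sommerfeldKernel, Complex.sin_mul_I]
    push_cast
    congr 1
    linear_combination (R * Complex.sinh y) * Complex.I_sq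
  simp only [zpow_zero, mul_one, add_zero, neg_zero, Complex.ofReal_zero, zero_add, h,
    add_mul, one_mul]
  simp only [sommerfeldKernel, Complex.ofReal_sin]

lemma half_mul_exp_sub_inv (x v : ℂ) :
    x / 2 * (Complex.exp (Complex.I * v) - (Complex.exp (Complex.I * v))⁻¹) =
      Complex.I * (x * Complex.sin v) := by
  rw [← Complex.exp_neg, Complex.sin, neg_mul, mul_comm Complex.I v]
  linear_combination (-x / 2 * (Complex.exp (-(v * Complex.I)) - Complex.exp (v * Complex.I))) *
    Complex.I_sq

lemma hasSum_besselCoeff_mul_hankelH1_eq_hankelH1_zero {x z R s φ : ℝ} (hx : 0 ≤ x) (hxz : x < z)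
    (hR : 0 < R) (hs : |s| < Real.pi / 2) (hcos : R * Real.cos s = z - x * Real.cos φ)
    (hsin : R * Real.sin s = x * Real.sin φ) :
    HasSum (fun p => (besselCoeff x p : ℂ) * Complex.exp (Complex.I * φ) ^ besselDegree p *
      hankelH1 (besselDegree p) z) (hankelH1 0 R) := by
  have h := hasSum_besselCoeff_mul_hankelH1 hx hxz (w := Complex.exp (Complex.I * φ))
    (Complex.norm_exp_I_mul_ofReal φ)
  have hcosC : (R : ℂ) * Complex.cos s = z - x * Complex.cos φ := by exact_mod_cast hcos
  have hsinC : (R : ℂ) * Complex.sin s = x * Complex.sin φ := by exact_mod_cast hsin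
  have hadd (u : ℂ) : R * Complex.sin (s + u) = z * Complex.sin u + x * Complex.sin (φ - u) := by
    rw [Complex.sin_add, Complex.sin_sub]
    linear_combination Complex.cos u * hsinC + Complex.sin u * hcosC
  have hsub (u : ℂ) : R * Complex.sin (-s + u) = z * Complex.sin u - x * Complex.sin (φ + u) := by
    rw [Complex.sin_add, Complex.sin_add, Complex.sin_neg, Complex.cos_neg]
    linear_combination -Complex.cos u * hsinC + Complex.sin u * hcosC
  have e1 (t : ℝ) : Complex.exp (Complex.I * (z * Real.sin t)) * Complex.exp (x / 2 *
      (Complex.exp (Complex.I * φ) * Complex.exp (-Complex.I * t) -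
        (Complex.exp (Complex.I * φ) * Complex.exp (-Complex.I * t))⁻¹)) =
      sommerfeldKernel R ((t + s : ℝ) : ℂ) := by
    rw [← Complex.exp_add (Complex.I * φ),
      show Complex.I * φ + -Complex.I * t = Complex.I * (φ - t : ℂ) by ring,
      half_mul_exp_sub_inv, ← Complex.exp_add, sommerfeldKernel, Complex.ofReal_add,
      add_comm (t : ℂ), hadd, ← mul_add, Complex.ofReal_sin]
  have hsinh (y : ℝ) : ((-z * Real.sinh y : ℝ) : ℂ) =
      Complex.I * (z * Complex.sin (y * Complex.I)) := by
    rw [Complex.sin_mul_I]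
    push_cast
    linear_combination (-z * Complex.sinh y) * Complex.I_sq
  have e2 (y : ℝ) : (Complex.exp (x / 2 * (Complex.exp (Complex.I * φ) * Real.exp y -
        (Complex.exp (Complex.I * φ) * Real.exp y)⁻¹)) +
      Complex.exp (x / 2 * (Complex.exp (Complex.I * φ) * -(Real.exp (-y)) -
        (Complex.exp (Complex.I * φ) * -(Real.exp (-y)))⁻¹))) * Real.exp (-z * Real.sinh y) =
      sommerfeldKernel R (s + y * Complex.I) +
        sommerfeldKernel R (((-s : ℝ) : ℂ) + y * Complex.I) := by
    have a1 : Complex.exp (Complex.I * φ) * Real.exp y =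
        Complex.exp (Complex.I * (φ - y * Complex.I)) := by
      rw [Complex.ofReal_exp, ← Complex.exp_add]
      congr 1
      linear_combination (y : ℂ) * Complex.I_sq
    have a2 : Complex.exp (Complex.I * φ) * -(Real.exp (-y)) =
        Complex.exp (Complex.I * (φ + y * Complex.I + Real.pi)) := by
      rw [mul_add _ _ (Real.pi : ℂ), Complex.exp_add, mul_comm Complex.I (Real.pi : ℂ),
        Complex.exp_pi_mul_I, mul_neg_one, mul_neg, Complex.ofReal_exp, ← Complex.exp_add]
      congr 2
      push_cast
      linear_combination -(y : ℂ) * Complex.I_sq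
    rw [a1, a2, half_mul_exp_sub_inv, half_mul_exp_sub_inv, Complex.sin_add_pi, Complex.ofReal_exp,
      hsinh, add_mul, ← Complex.exp_add, ← Complex.exp_add, sommerfeldKernel, sommerfeldKernel,
      Complex.ofReal_neg, hadd, hsub]
    congr 2 <;> ring
  simp only [e1, e2] at h
  rwa [hankelH1_zero_eq, ← sommerfeldIntegral_eq hR hs]

lemma hasSum_hankelH1_mul_besselJ {x z R s φ : ℝ} (hx : 0 ≤ x) (hxz : x < z)
    (hR : 0 < R) (hs : |s| < Real.pi / 2) (hcos : R * Real.cos s = z - x * Real.cos φ)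
    (hsin : R * Real.sin s = x * Real.sin φ) :
    HasSum (fun m : ℤ => hankelH1 m z * (besselJ m x : ℂ) *
      Complex.exp (Complex.I * (m : ℂ) * (φ : ℂ))) (hankelH1 0 R) := by
  have h := hasSum_besselCoeff_mul_hankelH1_eq_hankelH1_zero hx hxz hR hs hcos hsin
  refine ((Equiv.sigmaFiberEquiv besselDegree).hasSum_iff.2 h).sigma fun m => ?_
  have hJ : HasSum (fun p : {p // besselDegree p = m} => besselCoeff x p) (besselJ m x) := by
    refine (hasSum_subtype_iff_indicator (f := besselCoeff x) (s := {p | besselDegree p = m})).2 ?_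
    refine (hasSum_besselJ m hx).congr_fun fun p => ?_
    simp [Set.indicator_apply]
  have hJC := (Complex.ofRealCLM.hasSum hJ).mul_left
    (hankelH1 m z * Complex.exp (Complex.I * (m : ℂ) * (φ : ℂ)))
  rw [Complex.ofRealCLM_apply, mul_right_comm (hankelH1 m z)] at hJC
  refine hJC.congr_fun ?_
  rintro ⟨p, rfl⟩
  simp only [Function.comp_apply, Equiv.sigmaFiberEquiv_apply, Complex.ofRealCLM_apply]
  rw [← Complex.exp_int_mul, mul_left_comm (besselDegree p : ℂ), ← mul_assoc Complex.I]
  ring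

lemma norm2_eq_norm (x : ℝ × ℝ) : norm2 x = ‖(x.1 + x.2 * Complex.I : ℂ)‖ := by
  rw [norm2, Complex.norm_add_mul_I]

lemma norm2_mul_exp_polarAngle (x : ℝ × ℝ) :
    (norm2 x : ℂ) * Complex.exp (polarAngle x * Complex.I) = x.1 + x.2 * Complex.I := by
  rw [norm2_eq_norm, polarAngle, Complex.norm_mul_exp_arg_mul_I]

/-- Law of cosines. -/
lemma norm2_sub_eq (b r : ℝ × ℝ) :
    norm2 (b - r) = ‖(norm2 b - norm2 r *
      Complex.exp ((-(polarAngle r - polarAngle b) : ℝ) * Complex.I) : ℂ)‖ := by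
  have h : (((b - r).1 : ℂ) + ((b - r).2 : ℂ) * Complex.I) =
      Complex.exp (polarAngle b * Complex.I) * (norm2 b - norm2 r *
        Complex.exp ((polarAngle r - polarAngle b : ℝ) * Complex.I)) := by
    have hexp : Complex.exp (polarAngle b * Complex.I) *
        Complex.exp ((polarAngle r - polarAngle b : ℝ) * Complex.I) =
        Complex.exp (polarAngle r * Complex.I) := by
      rw [← Complex.exp_add]
      congr 1
      push_cast
      ring
    rw [Prod.fst_sub, Prod.snd_sub]
    push_cast at hexp ⊢
    linear_combination -(norm2_mul_exp_polarAngle b) + norm2_mul_exp_polarAngle r +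
      norm2 r * hexp
  rw [norm2_eq_norm, h, norm_mul, Complex.norm_exp_ofReal_mul_I, one_mul, ← Complex.norm_conj]
  congr 1
  simp [← Complex.exp_conj, ← neg_mul]

/-- Graf's addition theorem: for `0 < ‖r‖ < ‖b‖`, with `α, θ` the polar angles of `b, r`,
`H_0^{(1)}(k‖b - r‖) = Σ_{m ∈ ℤ} H_m^{(1)}(k‖b‖) J_m(k‖r‖) e^{i m (θ - α)}`,
the series converging absolutely. -/
theorem graf_addition (k : ℝ) (hk : 0 < k) (b r : ℝ × ℝ) (hr : 0 < norm2 r)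
    (hbr : norm2 r < norm2 b) :
    HasSum
      (fun m : ℤ => hankelH1 m (k * norm2 b) * (besselJ m (k * norm2 r) : ℂ) *
        Complex.exp (Complex.I * (m : ℂ) * ((polarAngle r - polarAngle b : ℝ) : ℂ)))
      (hankelH1 0 (k * norm2 (b - r)))
    ∧ Summable (fun m : ℤ => ‖hankelH1 m (k * norm2 b) * (besselJ m (k * norm2 r) : ℂ) *
        Complex.exp (Complex.I * (m : ℂ) * ((polarAngle r - polarAngle b : ℝ) : ℂ))‖) := by
  set φ := polarAngle r - polarAngle b
  have hb : 0 < norm2 b := hr.trans hbr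
  set q : ℂ := norm2 b - norm2 r * Complex.exp ((-φ : ℝ) * Complex.I) with hq
  have hre : q.re = norm2 b - norm2 r * Real.cos φ := by
    rw [hq, Complex.sub_re, Complex.ofReal_re, Complex.re_ofReal_mul,
      Complex.exp_ofReal_mul_I_re, Real.cos_neg]
  have him : q.im = norm2 r * Real.sin φ := by
    rw [hq, Complex.sub_im, Complex.ofReal_im, Complex.im_ofReal_mul,
      Complex.exp_ofReal_mul_I_im, Real.sin_neg]
    ring
  have hpos : 0 < q.re := by
    rw [hre]
    nlinarith [mul_le_of_le_one_right hr.le (Real.cos_le_one φ)]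
  have hq0 : 0 < ‖q‖ := hpos.trans_le (Complex.re_le_norm q)
  have hR : norm2 (b - r) = ‖q‖ := norm2_sub_eq b r
  have hsum := hasSum_hankelH1_mul_besselJ (x := k * norm2 r) (z := k * norm2 b)
    (R := k * norm2 (b - r)) (s := q.arg) (φ := φ) (by positivity)
    (mul_lt_mul_of_pos_left hbr hk) (by rw [hR]; positivity)
    (Complex.abs_arg_lt_pi_div_two_iff.2 (Or.inl hpos))
    (by rw [hR, mul_assoc, Complex.norm_mul_cos_arg, hre]; ring)
    (by rw [hR, mul_assoc, Complex.norm_mul_sin_arg, him]; ring)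
  exact ⟨hsum, hsum.summable.norm⟩
end

section
/- For two disjoint disks Ω_p, Ω_q of radii a_p, a_q centered at O_p, O_q, the (m,n) entry of the off-diagonal single-layer block satisfies ⟨L φ_n^q, φ_m^p⟩ = (iπ√(a_p a_q)/2) J_m(k a_p) S_{n,m}^{p,q} J_n(k a_q), where S_{n,m}^{p,q} = H_{n−m}^{(1)}(k b_{pq}) e^{i(n−m)α_{pq}}, b_{pq} = ‖O_q O_p‖ and α_{pq} is the angle of the vector from O_q to O_p. -/
open Complex Real MeasureTheory Filter

lemma integrableOn_exp_sub_sinh (c : ℝ) {a : ℝ} (ha : 0 < a) :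
    IntegrableOn (fun t : ℝ => Real.exp (c * t - a * Real.sinh t)) (Set.Ioi 0) := by
  refine integrable_of_isBigO_exp_neg (b := 1) one_pos (by fun_prop) ?_
  refine Asymptotics.IsBigO.of_bound (Real.exp ((c + 1) ^ 2 / a)) ?_
  filter_upwards [eventually_ge_atTop (0 : ℝ)] with t ht
  rw [Real.norm_of_nonneg (Real.exp_pos _).le, Real.norm_of_nonneg (Real.exp_pos _).le,
    ← Real.exp_add, Real.exp_le_exp]
  have h1 : t ^ 2 / 4 ≤ Real.sinh t := by
    have h2 := Real.quadratic_le_exp_of_nonneg ht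
    have h3 : Real.exp (-t) ≤ 1 := Real.exp_le_one_iff.2 (by linarith)
    rw [Real.sinh_eq]
    linarith
  have h4 : a * (t ^ 2 / 4) ≤ a * Real.sinh t := mul_le_mul_of_nonneg_left h1 ha.le
  have h5 : (c + 1) * t - a * (t ^ 2 / 4) ≤ (c + 1) ^ 2 / a := by
    rw [le_div_iff₀ ha]
    nlinarith [sq_nonneg (a * t / 2 - (c + 1))]
  linarith

/-- The integral of `F` over the contour running from `-∞` to `0` to `πi` to `πi + ∞`. -/
noncomputable def hankelContour (F : ℂ → ℂ) : ℂ :=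
  (∫ t in Set.Ioi (0 : ℝ), F (-(t : ℂ))) + Complex.I * (∫ s in (0 : ℝ)..Real.pi, F (s * Complex.I))
    + ∫ t in Set.Ioi (0 : ℝ), F (t + Real.pi * Complex.I)

lemma hankelContour_const_mul (c : ℂ) (F : ℂ → ℂ) :
    hankelContour (fun w => c * F w) = c * hankelContour F := by
  simp only [hankelContour, integral_const_mul, intervalIntegral.integral_const_mul]
  ring

lemma exp_int_mul_pi_mul_I (n : ℤ) : Complex.exp (-(n * (Real.pi * Complex.I))) = (-1) ^ n := by
  rw [Complex.exp_neg, Complex.exp_int_mul, Complex.exp_pi_mul_I, ← inv_zpow]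
  norm_num

lemma hankelH1_eq_hankelContour (n : ℤ) {z : ℝ} (hz : 0 < z) :
    hankelH1 n z = (Real.pi * Complex.I)⁻¹ *
      hankelContour (fun w => Complex.exp (z * Complex.sinh w - n * w)) := by
  have hpi : (Real.pi : ℂ) ≠ 0 := by exact_mod_cast Real.pi_ne_zero
  have e1 : (∫ t in Set.Ioi (0 : ℝ), Complex.exp (z * Complex.sinh (-(t : ℂ)) - n * (-(t : ℂ)))) =
      ((∫ t in Set.Ioi (0 : ℝ), Real.exp (n * t - z * Real.sinh t) : ℝ) : ℂ) := by
    rw [← integral_complex_ofReal]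
    congr 1
    ext t
    push_cast
    rw [Complex.sinh_neg]
    ring_nf
  have e3 : (∫ t in Set.Ioi (0 : ℝ), Complex.exp (z * Complex.sinh (t + Real.pi * Complex.I)
        - n * (t + Real.pi * Complex.I))) =
      ((∫ t in Set.Ioi (0 : ℝ), (-1) ^ n * Real.exp (-n * t - z * Real.sinh t) : ℝ) : ℂ) := by
    rw [← integral_complex_ofReal]
    congr 1
    ext t
    push_cast
    rw [Complex.sinh_add_pi_mul_I, ← exp_int_mul_pi_mul_I, ← Complex.exp_add]
    ring_nf
  have e2 : (∫ s in (0 : ℝ)..Real.pi,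
        Complex.exp (z * Complex.sinh (s * Complex.I) - n * (s * Complex.I))) =
      ((∫ s in (0 : ℝ)..Real.pi, Real.cos (z * Real.sin s - n * s) : ℝ) : ℂ) +
      ((∫ s in (0 : ℝ)..Real.pi, Real.sin (z * Real.sin s - n * s) : ℝ) : ℂ) * Complex.I := by
    rw [← intervalIntegral.integral_ofReal, ← intervalIntegral.integral_ofReal,
      ← intervalIntegral.integral_mul_const, ← intervalIntegral.integral_add]
    · congr 1
      ext s
      push_cast
      rw [← Complex.exp_mul_I, Complex.sinh_mul_I]
      ring_nf
    · exact (by fun_prop : Continuous _).intervalIntegrable _ _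
    · exact (by fun_prop : Continuous _).intervalIntegrable _ _
  have e4 : (∫ t in Set.Ioi (0:ℝ),
        (Real.exp ((n : ℝ) * t) + (-1 : ℝ) ^ n * Real.exp (-(n : ℝ) * t)) *
          Real.exp (-z * Real.sinh t)) =
      (∫ t in Set.Ioi (0 : ℝ), Real.exp (n * t - z * Real.sinh t)) +
      ∫ t in Set.Ioi (0 : ℝ), (-1) ^ n * Real.exp (-n * t - z * Real.sinh t) := by
    rw [← integral_add (integrableOn_exp_sub_sinh _ hz)
      ((integrableOn_exp_sub_sinh _ hz).const_mul _)]
    congr 1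
    ext t
    rw [add_mul, mul_assoc, ← Real.exp_add, ← Real.exp_add]
    ring_nf
  rw [hankelContour, e1, e2, e3, hankelH1, besselJ, besselY, e4]
  push_cast
  field_simp
  ring_nf
  simp only [Complex.I_sq]
  ring

lemma integral_exp_sinh_sub (m : ℤ) (z : ℝ) :
    ∫ t in (0 : ℝ)..(2 * Real.pi),
      Complex.exp (z * Complex.sinh (t * Complex.I) - m * (t * Complex.I)) =
      2 * Real.pi * besselJ m z := by
  set f : ℝ → ℂ := fun t =>
    Complex.exp (z * Complex.sinh (t * Complex.I) - m * (t * Complex.I)) with hf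
  have hc : Continuous f := by fun_prop
  have hper : Function.Periodic f (2 * Real.pi) := by
    intro t
    simp only [hf]
    rw [Complex.exp_eq_exp_iff_exists_int]
    refine ⟨-m, ?_⟩
    push_cast
    rw [add_mul, Complex.sinh_add]
    simp [Complex.sinh_mul_I, Complex.cosh_mul_I]
    ring
  have h1 := hper.intervalIntegral_add_eq 0 (-Real.pi)
  rw [zero_add, show -Real.pi + 2 * Real.pi = Real.pi by ring] at h1
  rw [h1, ← intervalIntegral.integral_add_adjacent_intervals (hc.intervalIntegrable _ 0)
    (hc.intervalIntegrable _ _)]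
  have h2 : ∫ t in (-Real.pi)..0, f t = ∫ t in (0 : ℝ)..Real.pi, f (-t) := by
    rw [intervalIntegral.integral_comp_neg, neg_zero]
  have hc' : Continuous fun t => f (-t) := hc.comp continuous_neg
  rw [h2, ← intervalIntegral.integral_add (hc'.intervalIntegrable _ _)
    (hc.intervalIntegrable _ _), besselJ]
  have hpi : (Real.pi : ℂ) ≠ 0 := by exact_mod_cast Real.pi_ne_zero
  push_cast
  rw [← mul_assoc, show (2 * Real.pi * (1 / Real.pi) : ℂ) = 2 by field_simp,
    ← intervalIntegral.integral_ofReal, ← intervalIntegral.integral_const_mul]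
  refine intervalIntegral.integral_congr fun t _ => ?_
  simp only [hf]
  push_cast
  rw [Complex.two_cos, add_comm]
  congr 2 <;> simp [Complex.sinh_mul_I] <;> ring

lemma integral_exp_sinh_add (m : ℤ) (z : ℝ) (w : ℂ) :
    ∫ t in (0 : ℝ)..(2 * Real.pi),
      Complex.exp (z * Complex.sinh (w + t * Complex.I) - m * (w + t * Complex.I)) =
      2 * Real.pi * besselJ m z := by
  set K : ℂ → ℂ := fun v => Complex.exp (z * Complex.sinh v - m * v) with hK
  have hper : ∀ v, K (v + 2 * Real.pi * Complex.I) = K v := by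
    intro v
    simp only [hK]
    rw [Complex.exp_eq_exp_iff_exists_int]
    refine ⟨-m, ?_⟩
    push_cast
    have h2 : Complex.sinh (v + 2 * Real.pi * Complex.I) = Complex.sinh v := by
      rw [two_mul, add_mul, ← add_assoc, Complex.sinh_add_pi_mul_I, Complex.sinh_add_pi_mul_I,
        neg_neg]
    rw [h2]
    ring
  have hshift : ∫ t in (0 : ℝ)..(2 * Real.pi), K (w + t * Complex.I) =
      ∫ t in (0 : ℝ)..(2 * Real.pi), K (w.re + t * Complex.I) := by
    have hp : Function.Periodic (fun t : ℝ => K (w.re + t * Complex.I)) (2 * Real.pi) := by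
      intro t
      simp only
      rw [← hper (w.re + t * Complex.I)]
      push_cast
      ring_nf
    have h1 := hp.intervalIntegral_add_eq 0 w.im
    rw [zero_add] at h1
    have h2 := intervalIntegral.integral_comp_add_right (a := 0) (b := 2 * Real.pi)
      (fun t : ℝ => K (w.re + t * Complex.I)) w.im
    rw [zero_add, add_comm (2 * Real.pi)] at h2
    rw [h1, ← h2]
    refine intervalIntegral.integral_congr fun t _ => ?_
    congr 1
    nth_rw 1 [← Complex.re_add_im w]
    push_cast
    ring
  have hrect := Complex.integral_boundary_rect_eq_zero_of_differentiableOn K 0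
    (w.re + (2 * Real.pi : ℝ) * Complex.I) (by
      have : Differentiable ℂ K := by fun_prop
      exact this.differentiableOn)
  have hre : ((w.re : ℂ) + (2 * Real.pi : ℝ) * Complex.I).re = w.re := by simp
  have him : ((w.re : ℂ) + (2 * Real.pi : ℝ) * Complex.I).im = 2 * Real.pi := by simp
  rw [hre, him] at hrect
  have hh : ∀ x : ℝ, K (x + ((2 * Real.pi : ℝ) : ℂ) * Complex.I) = K x := by
    intro x
    rw [← hper x]
    push_cast
    rfl
  simp only [hh, Complex.zero_re, Complex.zero_im, Complex.ofReal_zero, zero_mul, add_zero,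
    sub_self, zero_add, smul_eq_mul] at hrect
  change ∫ t in (0 : ℝ)..(2 * Real.pi), K (w + t * Complex.I) = _
  rw [hshift, ← integral_exp_sinh_sub]
  exact mul_left_cancel₀ Complex.I_ne_zero (sub_eq_zero.1 hrect)

lemma integral_exp_sinh_mul_exp (m : ℤ) (z α : ℝ) (w : ℂ) :
    ∫ t in (0 : ℝ)..(2 * Real.pi), Complex.exp (z * Complex.sinh (w + (t - α : ℝ) * Complex.I)) *
        Complex.exp (-(m * (t * Complex.I))) =
      2 * Real.pi * besselJ m z * Complex.exp (m * (w - α * Complex.I)) := by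
  rw [← integral_exp_sinh_add m z (w - α * Complex.I), ← intervalIntegral.integral_mul_const]
  refine intervalIntegral.integral_congr fun t _ => ?_
  rw [← Complex.exp_add, ← Complex.exp_add]
  push_cast
  ring_nf

lemma besselJ_neg_neg (m : ℤ) (z : ℝ) : besselJ (-m) (-z) = besselJ m z := by
  simp only [besselJ]
  congr 1
  refine intervalIntegral.integral_congr fun t _ => ?_
  rw [← Real.cos_neg]
  push_cast
  ring_nf

lemma integrable_prod_of_norm_le {f : ℝ → ℝ → ℂ} (hf : Continuous (Function.uncurry f)) {g : ℝ → ℝ}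
    (hg : IntegrableOn g (Set.Ioi 0)) (hb : ∀ t, ∀ τ > 0, ‖f t τ‖ ≤ g τ) (a b : ℝ) :
    Integrable (Function.uncurry f)
      ((volume.restrict (Set.Ioc a b)).prod (volume.restrict (Set.Ioi (0 : ℝ)))) := by
  refine Integrable.mono' (hg.comp_snd (volume.restrict (Set.Ioc a b)))
    hf.aestronglyMeasurable ?_
  rw [Measure.prod_restrict]
  filter_upwards [ae_restrict_mem (measurableSet_Ioc.prod measurableSet_Ioi)] with p hp
  exact hb p.1 p.2 hp.2

lemma intervalIntegral_hankelContour_swap {F : ℝ → ℂ → ℂ} (hF : Continuous (Function.uncurry F))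
    {g : ℝ → ℝ} (hg : IntegrableOn g (Set.Ioi 0))
    (hb₁ : ∀ t, ∀ τ > (0 : ℝ), ‖F t (-(τ : ℂ))‖ ≤ g τ)
    (hb₂ : ∀ t, ∀ τ > (0 : ℝ), ‖F t (τ + Real.pi * Complex.I)‖ ≤ g τ) {a b : ℝ} (hab : a ≤ b) :
    ∫ t in a..b, hankelContour (F t) = hankelContour fun w => ∫ t in a..b, F t w := by
  have h₁ := integrable_prod_of_norm_le (f := fun t τ => F t (-(τ : ℂ)))
    (hF.comp (by fun_prop : Continuous fun p : ℝ × ℝ => (p.1, -(p.2 : ℂ)))) hg hb₁ a b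
  have h₂ := integrable_prod_of_norm_le (f := fun t τ => F t (τ + Real.pi * Complex.I))
    (hF.comp (by fun_prop : Continuous fun p : ℝ × ℝ => (p.1, (p.2 : ℂ) + Real.pi * Complex.I)))
    hg hb₂ a b
  have h₃ : Continuous (Function.uncurry fun (t s : ℝ) => F t (s * Complex.I)) :=
    hF.comp (by fun_prop : Continuous fun p : ℝ × ℝ => (p.1, (p.2 : ℂ) * Complex.I))
  have i₁ : IntervalIntegrable (fun t => ∫ τ in Set.Ioi (0 : ℝ), F t (-(τ : ℂ))) volume a b :=
    (intervalIntegrable_iff_integrableOn_Ioc_of_le hab).2 h₁.integral_prod_left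
  have i₂ : IntervalIntegrable (fun t => ∫ τ in Set.Ioi (0 : ℝ), F t (τ + Real.pi * Complex.I))
      volume a b :=
    (intervalIntegrable_iff_integrableOn_Ioc_of_le hab).2 h₂.integral_prod_left
  have i₃ : IntervalIntegrable (fun t => ∫ s in (0 : ℝ)..Real.pi, F t (s * Complex.I))
      volume a b :=
    (intervalIntegral.continuous_parametric_intervalIntegral_of_continuous' h₃ _ _).intervalIntegrable
      _ _
  simp only [hankelContour]
  rw [intervalIntegral.integral_add (i₁.add (i₃.const_mul _)) i₂,
    intervalIntegral.integral_add i₁ (i₃.const_mul _), intervalIntegral.integral_const_mul]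
  congr 2
  · simp only [intervalIntegral.integral_of_le hab]
    exact integral_integral_swap h₁
  · rw [intervalIntegral_intervalIntegral_swap]
    rw [Set.uIoc_of_le hab, Set.uIoc_of_le Real.pi_pos.le]
    exact (h₃.continuousOn.integrableOn_compact
      (isCompact_Icc.prod isCompact_Icc)).mono_set
        (Set.prod_mono Set.Ioc_subset_Icc_self Set.Ioc_subset_Icc_self)
  · simp only [intervalIntegral.integral_of_le hab]
    exact integral_integral_swap h₂

lemma norm_exp_neg_mul_sinh (r t β : ℝ) :
    ‖Complex.exp (-(r * Complex.sinh (t + β * Complex.I)))‖ =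
      Real.exp (-(r * (Real.sinh t * Real.cos β))) := by
  rw [Complex.norm_exp, Complex.sinh_add, Complex.sinh_mul_I, Complex.cosh_mul_I]
  simp [← Complex.ofReal_sinh, ← Complex.ofReal_cosh, ← Complex.ofReal_sin, ← Complex.ofReal_cos]

lemma norm_cosh_add_mul_I_le {t : ℝ} (ht : 0 ≤ t) (β : ℝ) :
    ‖Complex.cosh (t + β * Complex.I)‖ ≤ Real.exp t := by
  have h1 : ‖Complex.exp (t + β * Complex.I)‖ = Real.exp t := by
    rw [Complex.norm_exp]; simp
  have h2 : ‖Complex.exp (-(t + β * Complex.I))‖ ≤ Real.exp t := by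
    rw [Complex.norm_exp]
    simp only [Complex.neg_re, Complex.add_re, Complex.ofReal_re, Complex.re_ofReal_mul,
      Complex.I_re, mul_zero, add_zero]
    exact Real.exp_le_exp.2 (by linarith)
  rw [Complex.cosh, norm_div, Complex.norm_ofNat, div_le_iff₀ two_pos]
  calc _ ≤ _ := norm_add_le _ _
    _ ≤ _ := by linarith

lemma hasDerivAt_integral_exp_neg_mul_sinh {r : ℝ} (hr : 0 < r) {β : ℝ}
    (hβ : β ∈ Set.Ioo (-(Real.pi / 2)) (Real.pi / 2)) :
    HasDerivAt (fun b : ℝ => ∫ t in Set.Ioi (0 : ℝ),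
        Complex.exp (-(r * Complex.sinh (t + b * Complex.I))))
      (-(Complex.I * Complex.exp (-(r * Complex.sinh (β * Complex.I))))) β := by
  have hcos : 0 < Real.cos β := Real.cos_pos_of_mem_Ioo hβ
  set c := Real.cos β / 2 with hc
  have hc0 : 0 < c := by positivity
  have hs : {b : ℝ | c < Real.cos b} ∈ nhds β :=
    (isOpen_lt continuous_const Real.continuous_cos).mem_nhds (by
      change c < Real.cos β
      linarith)
  set F' : ℝ → ℝ → ℂ := fun b t => Complex.exp (-(r * Complex.sinh (t + b * Complex.I))) *
    (-(r * Complex.cosh (t + b * Complex.I))) with hF'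
  have hbound : ∀ t > (0 : ℝ), ∀ b ∈ {b : ℝ | c < Real.cos b},
      ‖Complex.exp (-(r * Complex.sinh (t + b * Complex.I)))‖ ≤
        Real.exp (-(r * c * Real.sinh t)) := by
    intro t ht b hb
    rw [norm_exp_neg_mul_sinh, Real.exp_le_exp, neg_le_neg_iff, mul_assoc, mul_comm c]
    exact mul_le_mul_of_nonneg_left
      (mul_le_mul_of_nonneg_left (le_of_lt hb) (Real.sinh_nonneg_iff.2 ht.le)) hr.le
  have hbound' : ∀ t > (0 : ℝ), ∀ b ∈ {b : ℝ | c < Real.cos b},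
      ‖F' b t‖ ≤ r * Real.exp (1 * t - r * c * Real.sinh t) := by
    intro t ht b hb
    rw [hF', norm_mul, norm_neg, norm_mul, Complex.norm_real, Real.norm_of_nonneg hr.le, one_mul,
      sub_eq_add_neg, Real.exp_add]
    calc _ ≤ Real.exp (-(r * c * Real.sinh t)) * (r * Real.exp t) :=
          mul_le_mul (hbound t ht b hb)
            (mul_le_mul_of_nonneg_left (norm_cosh_add_mul_I_le ht.le b) hr.le)
            (by positivity) (by positivity)
      _ = _ := by ring
  have hI1 := (integrableOn_exp_sub_sinh 1 (mul_pos hr hc0)).const_mul r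
  have hderiv : ∀ v : ℂ, HasDerivAt (fun v => Complex.exp (-(r * Complex.sinh v)))
      (Complex.exp (-(r * Complex.sinh v)) * (-(r * Complex.cosh v))) v := fun v =>
    ((Complex.hasDerivAt_sinh v).const_mul (r : ℂ)).neg.cexp
  have hmain := hasDerivAt_integral_of_dominated_loc_of_deriv_le (μ := volume.restrict (Set.Ioi 0))
    (F := fun (b : ℝ) (t : ℝ) => Complex.exp (-(r * Complex.sinh (t + b * Complex.I))))
    (F' := fun b t => F' b t * Complex.I) hs
    (Eventually.of_forall fun b => (by fun_prop : Continuous _).aestronglyMeasurable) (by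
      refine Integrable.mono' (integrableOn_exp_sub_sinh 0 (mul_pos hr hc0))
        (by fun_prop : Continuous _).aestronglyMeasurable ?_
      filter_upwards [ae_restrict_mem measurableSet_Ioi] with t ht
      simpa using hbound t ht β (mem_of_mem_nhds hs))
    (by fun_prop : Continuous _).aestronglyMeasurable (by
      filter_upwards [ae_restrict_mem measurableSet_Ioi] with t ht b hb
      rw [norm_mul, Complex.norm_I, mul_one]
      exact hbound' t ht b hb) hI1 (by
      refine Eventually.of_forall fun t b _ => ?_
      have h1 : HasDerivAt (fun b : ℝ => (t : ℂ) + b * Complex.I) Complex.I b := by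
        simpa using ((hasDerivAt_id b).ofReal_comp.mul_const Complex.I).const_add (t : ℂ)
      exact (hderiv _).comp b h1)
  refine hmain.2.congr_deriv ?_
  rw [integral_mul_const]
  have hI2 : IntegrableOn (F' β) (Set.Ioi 0) := by
    refine Integrable.mono' hI1 (by fun_prop : Continuous _).aestronglyMeasurable ?_
    filter_upwards [ae_restrict_mem measurableSet_Ioi] with t ht
    exact hbound' t ht β (mem_of_mem_nhds hs)
  have hlim : Tendsto (fun t : ℝ => Complex.exp (-(r * Complex.sinh (t + β * Complex.I)))) atTop
      (nhds 0) := by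
    rw [tendsto_zero_iff_norm_tendsto_zero]
    simp only [norm_exp_neg_mul_sinh]
    refine Real.tendsto_exp_neg_atTop_nhds_zero.comp ?_
    refine Tendsto.const_mul_atTop hr (Tendsto.atTop_mul_const hcos ?_)
    refine tendsto_atTop_mono' _ ?_ tendsto_id
    filter_upwards [eventually_ge_atTop 0] with t ht using Real.self_le_sinh_iff.2 ht
  rw [integral_Ioi_of_hasDerivAt_of_tendsto'
    (f := fun t : ℝ => Complex.exp (-(r * Complex.sinh (t + β * Complex.I))))
    (fun t _ => ?_) hI2 hlim]
  · simp
    ring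
  · have h1 : HasDerivAt (fun t : ℝ => (t : ℂ) + β * Complex.I) 1 t := by
      simpa using (hasDerivAt_id t).ofReal_comp.add_const (β * Complex.I)
    exact ((hderiv _).comp t h1).congr_deriv (by rw [mul_one])

lemma integral_exp_neg_mul_sinh_eq {r : ℝ} (hr : 0 < r) {β : ℝ}
    (hβ : β ∈ Set.Ioo (-(Real.pi / 2)) (Real.pi / 2)) :
    ∫ t in Set.Ioi (0 : ℝ), Complex.exp (-(r * Complex.sinh (t + β * Complex.I))) =
      (∫ t in Set.Ioi (0 : ℝ), Complex.exp (-(r * Complex.sinh t))) -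
        Complex.I * ∫ u in (0 : ℝ)..β, Complex.exp (-(r * Complex.sinh (u * Complex.I))) := by
  set A : ℝ → ℂ := fun b => ∫ t in Set.Ioi (0 : ℝ),
    Complex.exp (-(r * Complex.sinh (t + b * Complex.I))) with hA
  set B : ℝ → ℂ := fun b => ∫ u in (0 : ℝ)..b, Complex.exp (-(r * Complex.sinh (u * Complex.I)))
  have hd : ∀ b ∈ Set.Ioo (-(Real.pi / 2)) (Real.pi / 2),
      HasDerivAt (fun b => A b + Complex.I * B b) 0 b := by
    intro b hb
    have h1 := hasDerivAt_integral_exp_neg_mul_sinh hr hb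
    have h2 : HasDerivAt B (Complex.exp (-(r * Complex.sinh (b * Complex.I)))) b :=
      (by fun_prop : Continuous fun u : ℝ =>
        Complex.exp (-(r * Complex.sinh (u * Complex.I)))).integral_hasStrictDerivAt 0 b
        |>.hasDerivAt
    exact (h1.add (h2.const_mul Complex.I)).congr_deriv (by ring)
  have h0 : (0 : ℝ) ∈ Set.Ioo (-(Real.pi / 2)) (Real.pi / 2) := by
    constructor <;> linarith [Real.pi_pos]
  have h := isOpen_Ioo.is_const_of_deriv_eq_zero isPreconnected_Ioo
    (fun b hb => (hd b hb).differentiableAt.differentiableWithinAt)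
    (fun b hb => (hd b hb).deriv) hβ h0
  have hA0 : A 0 = ∫ t in Set.Ioi (0 : ℝ), Complex.exp (-(r * Complex.sinh t)) := by simp [hA]
  have hB0 : B 0 = 0 := intervalIntegral.integral_same
  simp only [hA0, hB0, mul_zero, add_zero] at h
  exact eq_sub_of_add_eq h

lemma hankelContour_exp_mul_sinh_add {r : ℝ} (hr : 0 < r) {β : ℝ}
    (hβ : β ∈ Set.Ioo (-(Real.pi / 2)) (Real.pi / 2)) :
    hankelContour (fun w => Complex.exp (r * Complex.sinh (w + β * Complex.I))) =
      hankelContour (fun w => Complex.exp (r * Complex.sinh w)) := by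
  have hβ' : -β ∈ Set.Ioo (-(Real.pi / 2)) (Real.pi / 2) :=
    ⟨by linarith [hβ.2], by linarith [hβ.1]⟩
  set f : ℝ → ℂ := fun u => Complex.exp (r * Complex.sinh (u * Complex.I)) with hf
  have hfc : Continuous f := by fun_prop
  have e1 : ∀ b : ℝ, (∫ t in Set.Ioi (0 : ℝ),
      Complex.exp (r * Complex.sinh (-(t : ℂ) + b * Complex.I))) =
      ∫ t in Set.Ioi (0 : ℝ), Complex.exp (-(r * Complex.sinh (t + (-b : ℝ) * Complex.I))) := by
    intro b
    congr 1
    ext t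
    rw [← mul_neg, ← Complex.sinh_neg]
    push_cast
    ring_nf
  have e2 : ∀ b : ℝ, (∫ t in Set.Ioi (0 : ℝ),
      Complex.exp (r * Complex.sinh (t + Real.pi * Complex.I + b * Complex.I))) =
      ∫ t in Set.Ioi (0 : ℝ), Complex.exp (-(r * Complex.sinh (t + b * Complex.I))) := by
    intro b
    congr 1
    ext t
    rw [add_right_comm, Complex.sinh_add_pi_mul_I, mul_neg]
  have e3 : (∫ u in (0 : ℝ)..(-β), Complex.exp (-(r * Complex.sinh (u * Complex.I)))) =
      -∫ u in (0 : ℝ)..β, f u := by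
    have := intervalIntegral.integral_comp_neg (a := 0) (b := β)
      (fun u : ℝ => Complex.exp (-(r * Complex.sinh (u * Complex.I))))
    rw [neg_zero] at this
    rw [intervalIntegral.integral_symm, ← this]
    congr 1
    refine intervalIntegral.integral_congr fun u _ => ?_
    simp [hf]
  have e4 : (∫ u in (0 : ℝ)..β, Complex.exp (-(r * Complex.sinh (u * Complex.I)))) =
      ∫ u in Real.pi..(Real.pi + β), f u := by
    have := intervalIntegral.integral_comp_add_right (a := 0) (b := β) f Real.pi
    rw [zero_add, add_comm β] at this
    rw [← this]
    refine intervalIntegral.integral_congr fun u _ => ?_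
    simp only [hf]
    push_cast
    rw [add_mul, Complex.sinh_add_pi_mul_I, mul_neg]
  have e5 : (∫ s in (0 : ℝ)..Real.pi,
      Complex.exp (r * Complex.sinh (s * Complex.I + β * Complex.I))) =
      (∫ u in (0 : ℝ)..Real.pi, f u) + (∫ u in Real.pi..(Real.pi + β), f u) -
        ∫ u in (0 : ℝ)..β, f u := by
    have := intervalIntegral.integral_comp_add_right (a := 0) (b := Real.pi) f β
    rw [zero_add] at this
    rw [intervalIntegral.integral_add_adjacent_intervals (hfc.intervalIntegrable _ _)
      (hfc.intervalIntegrable _ _), intervalIntegral.integral_interval_sub_left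
      (hfc.intervalIntegrable _ _) (hfc.intervalIntegrable _ _), ← this]
    refine intervalIntegral.integral_congr fun u _ => ?_
    simp only [hf]
    push_cast
    ring_nf
  have e1' := e1 0
  have e2' := e2 0
  simp only [neg_zero, Complex.ofReal_zero, zero_mul, add_zero] at e1' e2'
  simp only [hankelContour]
  rw [e1, e2, e5, e1', e2', integral_exp_neg_mul_sinh_eq hr hβ,
    integral_exp_neg_mul_sinh_eq hr hβ', e3, e4]
  ring

lemma hankelH1_zero_sqrt {ξ : ℝ} (hξ : 0 < ξ) (η : ℝ) :
    hankelH1 0 (Real.sqrt (ξ ^ 2 + η ^ 2)) = (Real.pi * Complex.I)⁻¹ *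
      hankelContour (fun w => Complex.exp (ξ * Complex.sinh w + η * Complex.cosh w * Complex.I)) := by
  have hr : 0 < Real.sqrt (ξ ^ 2 + η ^ 2) := Real.sqrt_pos.2 (by positivity)
  set ζ : ℂ := ⟨ξ, η⟩ with hζ
  have hnorm : ‖ζ‖ = Real.sqrt (ξ ^ 2 + η ^ 2) := by
    rw [Complex.norm_eq_sqrt_sq_add_sq]
  have hβ : ζ.arg ∈ Set.Ioo (-(Real.pi / 2)) (Real.pi / 2) :=
    abs_lt.1 (Complex.abs_arg_lt_pi_div_two_iff.2 (Or.inl hξ))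
  have hc : Real.sqrt (ξ ^ 2 + η ^ 2) * Real.cos ζ.arg = ξ := by
    rw [← hnorm, Complex.norm_mul_cos_arg]
  have hs : Real.sqrt (ξ ^ 2 + η ^ 2) * Real.sin ζ.arg = η := by
    rw [← hnorm, Complex.norm_mul_sin_arg]
  rw [hankelH1_eq_hankelContour 0 hr]
  simp only [Int.cast_zero, zero_mul, sub_zero]
  rw [← hankelContour_exp_mul_sinh_add hr hβ]
  congr 2
  ext w
  rw [Complex.sinh_add, Complex.sinh_mul_I, Complex.cosh_mul_I]
  have hc' := congrArg Complex.ofReal hc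
  have hs' := congrArg Complex.ofReal hs
  push_cast at hc' hs'
  congr 1
  linear_combination Complex.sinh w * hc' + Complex.cosh w * Complex.I * hs'

lemma norm2_mul_cos_polarAngle (x : ℝ × ℝ) : norm2 x * Real.cos (polarAngle x) = x.1 := by
  have h : norm2 x = ‖(x.1 + x.2 * Complex.I : ℂ)‖ := (Complex.norm_add_mul_I _ _).symm
  rw [h, polarAngle, Complex.norm_mul_cos_arg]
  simp

lemma norm2_mul_sin_polarAngle (x : ℝ × ℝ) : norm2 x * Real.sin (polarAngle x) = x.2 := by
  have h : norm2 x = ‖(x.1 + x.2 * Complex.I : ℂ)‖ := (Complex.norm_add_mul_I _ _).symm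
  rw [h, polarAngle, Complex.norm_mul_sin_arg]
  simp

lemma phiP_circlePt (O : ℝ × ℝ) {a : ℝ} (ha : 0 < a) (m : ℤ) (t : ℝ) :
    phiP O a m (circlePt O a t) =
      Complex.exp (m * (t * Complex.I)) / (Real.sqrt (2 * Real.pi * a) : ℝ) := by
  have h : Complex.exp (polarAngle (circlePt O a t - O) * Complex.I) =
      Complex.exp (t * Complex.I) := by
    have h1 : (((circlePt O a t - O).1 : ℝ) + ((circlePt O a t - O).2 : ℝ) * Complex.I : ℂ) =
        a * Complex.exp (t * Complex.I) := by
      simp only [circlePt, Prod.fst_sub, Prod.snd_sub, add_sub_cancel_left]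
      rw [Complex.exp_mul_I]
      push_cast
      ring
    have ha' : (a : ℂ) ≠ 0 := by exact_mod_cast ha.ne'
    have h2 := Complex.norm_mul_exp_arg_mul_I (a * Complex.exp (t * Complex.I))
    rw [norm_mul, Complex.norm_exp_ofReal_mul_I, Complex.norm_real, Real.norm_of_nonneg ha.le,
      mul_one] at h2
    rw [polarAngle, h1]
    exact mul_left_cancel₀ ha' h2
  rw [phiP, Complex.exp_int_mul, ← h, ← Complex.exp_int_mul]
  ring_nf

lemma norm2_circlePt_sub_circlePt (Op Oq : ℝ × ℝ) (ap aq t s : ℝ) :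
    norm2 (circlePt Op ap t - circlePt Oq aq s) =
      Real.sqrt ((norm2 (Op - Oq) + ap * Real.cos (t - polarAngle (Op - Oq)) -
          aq * Real.cos (s - polarAngle (Op - Oq))) ^ 2 +
        (ap * Real.sin (t - polarAngle (Op - Oq)) -
          aq * Real.sin (s - polarAngle (Op - Oq))) ^ 2) := by
  have h1 := norm2_mul_cos_polarAngle (Op - Oq)
  have h2 := norm2_mul_sin_polarAngle (Op - Oq)
  set α := polarAngle (Op - Oq)
  set b := norm2 (Op - Oq)
  rw [norm2]
  congr 1
  have e1 : (circlePt Op ap t - circlePt Oq aq s).1 =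
      b * Real.cos α + ap * Real.cos t - aq * Real.cos s := by
    rw [h1]
    simp only [circlePt, Prod.fst_sub]
    ring
  have e2 : (circlePt Op ap t - circlePt Oq aq s).2 =
      b * Real.sin α + ap * Real.sin t - aq * Real.sin s := by
    rw [h2]
    simp only [circlePt, Prod.snd_sub]
    ring
  have hα := Real.sin_sq_add_cos_sq α
  rw [e1, e2, Real.cos_sub, Real.cos_sub, Real.sin_sub, Real.sin_sub]
  have hX : ∀ X Y : ℝ, X ^ 2 + Y ^ 2 = (X * Real.cos α + Y * Real.sin α) ^ 2 +
      (Y * Real.cos α - X * Real.sin α) ^ 2 := fun X Y => by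
    linear_combination -(X ^ 2 + Y ^ 2) * hα
  rw [hX]
  congr 2
  · linear_combination b * hα
  · ring

lemma G_circlePt_circlePt {k : ℝ} (hk : 0 < k) {Op Oq : ℝ × ℝ} {ap aq : ℝ} (hap : 0 < ap)
    (haq : 0 < aq) (hsep : ap + aq < norm2 (Op - Oq)) (t s : ℝ) :
    G k (circlePt Op ap t) (circlePt Oq aq s) = Complex.I / 4 * (Real.pi * Complex.I)⁻¹ *
      hankelContour fun w =>
        Complex.exp ((k * norm2 (Op - Oq) : ℝ) * Complex.sinh w +
          (k * ap : ℝ) * Complex.sinh (w + (t - polarAngle (Op - Oq) : ℝ) * Complex.I)) *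
        Complex.exp ((-(k * aq) : ℝ) *
          Complex.sinh (w + (s - polarAngle (Op - Oq) : ℝ) * Complex.I)) := by
  rw [G, norm2_circlePt_sub_circlePt]
  set α := polarAngle (Op - Oq)
  set b := norm2 (Op - Oq)
  set ξ := b + ap * Real.cos (t - α) - aq * Real.cos (s - α) with hξ
  set η := ap * Real.sin (t - α) - aq * Real.sin (s - α) with hη
  have hξ0 : 0 < ξ := by
    have h1 := mul_le_mul_of_nonneg_left (Real.neg_one_le_cos (t - α)) hap.le
    have h2 := mul_le_mul_of_nonneg_left (Real.cos_le_one (s - α)) haq.le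
    rw [hξ]
    linarith
  have hscale : k * Real.sqrt (ξ ^ 2 + η ^ 2) = Real.sqrt ((k * ξ) ^ 2 + (k * η) ^ 2) := by
    rw [mul_pow, mul_pow, ← mul_add, Real.sqrt_mul (sq_nonneg k), Real.sqrt_sq hk.le]
  rw [hscale, hankelH1_zero_sqrt (mul_pos hk hξ0), ← mul_assoc]
  congr 2
  ext w
  rw [← Complex.exp_add, Complex.sinh_add, Complex.sinh_add, Complex.sinh_mul_I,
    Complex.sinh_mul_I, Complex.cosh_mul_I, Complex.cosh_mul_I, hξ, hη]
  congr 1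
  push_cast
  ring

lemma sinh_neg_add_mul_I_re (τ θ : ℝ) :
    (Complex.sinh (-(τ : ℂ) + θ * Complex.I)).re = -(Real.sinh τ * Real.cos θ) := by
  rw [Complex.sinh_add, Complex.sinh_mul_I, Complex.cosh_mul_I, Complex.sinh_neg, Complex.cosh_neg]
  simp [← Complex.ofReal_sinh, ← Complex.ofReal_cosh, ← Complex.ofReal_sin, ← Complex.ofReal_cos]

lemma sinh_add_pi_mul_I_add_mul_I_re (τ θ : ℝ) :
    (Complex.sinh (τ + Real.pi * Complex.I + θ * Complex.I)).re =
      -(Real.sinh τ * Real.cos θ) := by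
  rw [add_right_comm, Complex.sinh_add_pi_mul_I, Complex.sinh_add, Complex.sinh_mul_I,
    Complex.cosh_mul_I]
  simp [← Complex.ofReal_sinh, ← Complex.ofReal_cosh, ← Complex.ofReal_sin, ← Complex.ofReal_cos]

lemma integral_hankelContour_source {b c d : ℝ} (hc : 0 < c) (hd : 0 < d) (hb : c + d < b)
    (n : ℤ) (α t : ℝ) :
    ∫ s in (0 : ℝ)..(2 * Real.pi), (hankelContour fun w =>
        Complex.exp (b * Complex.sinh w + c * Complex.sinh (w + (t - α : ℝ) * Complex.I)) *
        Complex.exp ((-d : ℝ) * Complex.sinh (w + (s - α : ℝ) * Complex.I))) *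
          Complex.exp (n * (s * Complex.I)) =
      2 * Real.pi * besselJ n d * hankelContour fun w =>
        Complex.exp (b * Complex.sinh w + c * Complex.sinh (w + (t - α : ℝ) * Complex.I)) *
          Complex.exp (-n * (w - α * Complex.I)) := by
  have key : ∀ s τ θ : ℝ, 0 < τ →
      b * -Real.sinh τ + c * -(Real.sinh τ * Real.cos θ) + -d * -(Real.sinh τ * Real.cos s) ≤
        0 * τ - (b - c - d) * Real.sinh τ := by
    intro s τ θ hτ
    have h0 := Real.sinh_pos_iff.2 hτ
    have h1 := mul_le_mul_of_nonneg_left (Real.neg_one_le_cos θ) (mul_pos hc h0).le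
    have h2 := mul_le_mul_of_nonneg_left (Real.cos_le_one s) (mul_pos hd h0).le
    nlinarith
  have h := intervalIntegral_hankelContour_swap (a := 0) (b := 2 * Real.pi)
    (F := fun s w => Complex.exp (n * (s * Complex.I)) *
      (Complex.exp (b * Complex.sinh w + c * Complex.sinh (w + (t - α : ℝ) * Complex.I)) *
        Complex.exp ((-d : ℝ) * Complex.sinh (w + (s - α : ℝ) * Complex.I))))
    (by fun_prop) (integrableOn_exp_sub_sinh 0 (by linarith : 0 < b - c - d))
    (fun s τ hτ => by
      rw [norm_mul, norm_mul, Complex.norm_exp, Complex.norm_exp, Complex.norm_exp,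
        ← Real.exp_add, ← Real.exp_add, Real.exp_le_exp]
      simp only [Complex.add_re, Complex.re_ofReal_mul, sinh_neg_add_mul_I_re, Complex.sinh_neg,
        Complex.neg_re, Complex.sinh_ofReal_re]
      simpa using key _ τ _ hτ)
    (fun s τ hτ => by
      rw [norm_mul, norm_mul, Complex.norm_exp, Complex.norm_exp, Complex.norm_exp,
        ← Real.exp_add, ← Real.exp_add, Real.exp_le_exp]
      simp only [Complex.add_re, Complex.re_ofReal_mul, sinh_add_pi_mul_I_add_mul_I_re,
        Complex.sinh_add_pi_mul_I, Complex.neg_re, Complex.sinh_ofReal_re]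
      simpa using key _ τ _ hτ) (by positivity)
  simp only [hankelContour_const_mul] at h
  rw [← hankelContour_const_mul]
  simp only [mul_comm _ (Complex.exp (n * (_ * Complex.I)))]
  rw [h]
  congr 1
  ext w
  have h2 := integral_exp_sinh_mul_exp (-n) (-d) α w
  rw [besselJ_neg_neg] at h2
  push_cast at h2 ⊢
  simp only [neg_mul, neg_neg] at h2 ⊢
  rw [mul_left_comm, ← h2, ← intervalIntegral.integral_const_mul]
  refine intervalIntegral.integral_congr fun s _ => ?_
  ring

lemma integral_hankelContour_target {b c : ℝ} (hc : 0 < c) (hb : c < b) (m n : ℤ) (α : ℝ) :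
    ∫ t in (0 : ℝ)..(2 * Real.pi), (hankelContour fun w =>
        Complex.exp (b * Complex.sinh w + c * Complex.sinh (w + (t - α : ℝ) * Complex.I)) *
          Complex.exp (-n * (w - α * Complex.I))) * Complex.exp (-(m * (t * Complex.I))) =
      2 * Real.pi * besselJ m c * Complex.exp (Complex.I * (n - m) * α) *
        (Real.pi * Complex.I * hankelH1 (n - m) b) := by
  have hpi : (Real.pi : ℂ) * Complex.I ≠ 0 :=
    mul_ne_zero (by exact_mod_cast Real.pi_ne_zero) Complex.I_ne_zero
  have key : ∀ τ θ ν : ℝ, 0 < τ → |ν| ≤ |(n : ℝ)| * τ →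
      b * -Real.sinh τ + c * -(Real.sinh τ * Real.cos θ) + ν ≤
        |(n : ℝ)| * τ - (b - c) * Real.sinh τ := by
    intro τ θ ν hτ hν
    have h0 := Real.sinh_pos_iff.2 hτ
    have h1 := mul_le_mul_of_nonneg_left (Real.neg_one_le_cos θ) (mul_pos hc h0).le
    nlinarith [le_abs_self ν]
  have h := intervalIntegral_hankelContour_swap (a := 0) (b := 2 * Real.pi)
    (F := fun t w => Complex.exp (-(m * (t * Complex.I))) *
      (Complex.exp (b * Complex.sinh w + c * Complex.sinh (w + (t - α : ℝ) * Complex.I)) *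
        Complex.exp (-n * (w - α * Complex.I))))
    (by fun_prop) (integrableOn_exp_sub_sinh |(n : ℝ)| (by linarith : 0 < b - c))
    (fun t τ hτ => by
      rw [norm_mul, norm_mul, Complex.norm_exp, Complex.norm_exp, Complex.norm_exp,
        ← Real.exp_add, ← Real.exp_add, Real.exp_le_exp]
      simp only [Complex.add_re, Complex.re_ofReal_mul, sinh_neg_add_mul_I_re, Complex.sinh_neg,
        Complex.neg_re, Complex.sinh_ofReal_re]
      simpa using key τ _ (n * τ) hτ (by rw [abs_mul, abs_of_pos hτ]))
    (fun t τ hτ => by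
      rw [norm_mul, norm_mul, Complex.norm_exp, Complex.norm_exp, Complex.norm_exp,
        ← Real.exp_add, ← Real.exp_add, Real.exp_le_exp]
      simp only [Complex.add_re, Complex.re_ofReal_mul, sinh_add_pi_mul_I_add_mul_I_re,
        Complex.sinh_add_pi_mul_I, Complex.neg_re, Complex.sinh_ofReal_re]
      simpa using key τ _ (-(n * τ)) hτ (by rw [abs_neg, abs_mul, abs_of_pos hτ]))
    (by positivity)
  simp only [hankelContour_const_mul] at h
  simp only [mul_comm _ (Complex.exp (-(m * (_ * Complex.I))))]
  rw [h, hankelH1_eq_hankelContour _ (hc.trans hb), mul_inv_cancel_left₀ hpi,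
    ← hankelContour_const_mul]
  congr 1
  ext w
  have h2 := integral_exp_sinh_mul_exp m c α w
  calc _ = Complex.exp (b * Complex.sinh w) * Complex.exp (-n * (w - α * Complex.I)) *
        ∫ t in (0 : ℝ)..(2 * Real.pi),
          Complex.exp (c * Complex.sinh (w + (t - α : ℝ) * Complex.I)) *
            Complex.exp (-(m * (t * Complex.I))) := by
        rw [← intervalIntegral.integral_const_mul]
        refine intervalIntegral.integral_congr fun t _ => ?_
        simp only [Complex.exp_add]
        ring
    _ = 2 * Real.pi * besselJ m c * (Complex.exp (b * Complex.sinh w) *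
        Complex.exp (-n * (w - α * Complex.I)) * Complex.exp (m * (w - α * Complex.I))) := by
        rw [h2]
        ring
    _ = _ := by
        rw [mul_assoc (2 * Real.pi * besselJ m c : ℂ), ← Complex.exp_add, ← Complex.exp_add,
          ← Complex.exp_add]
        push_cast
        ring_nf

/-- Off-diagonal single-layer block for two disjoint disks `Ω_p, Ω_q`:
`⟨L φ_n^q, φ_m^p⟩ = (iπ√(a_p a_q)/2) J_m(k a_p) S_{n,m}^{p,q} J_n(k a_q)` with
`S_{n,m}^{p,q} = H_{n-m}^{(1)}(k b_{pq}) e^{i (n-m) α_{pq}}`, where `b_{pq} = ‖O_p - O_q‖` and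
`α_{pq}` is the polar angle of `O_p - O_q`. -/
theorem singleLayer_offDiagonal (k : ℝ) (hk : 0 < k) (Op Oq : ℝ × ℝ) (ap aq : ℝ)
    (hap : 0 < ap) (haq : 0 < aq) (hsep : ap + aq < norm2 (Op - Oq)) (m n : ℤ) :
    (∫ t in (0:ℝ)..(2 * Real.pi),
        (∫ s in (0:ℝ)..(2 * Real.pi),
            G k (circlePt Op ap t) (circlePt Oq aq s) * phiP Oq aq n (circlePt Oq aq s) *
              (aq : ℂ)) *
          (starRingEnd ℂ) (phiP Op ap m (circlePt Op ap t)) * (ap : ℂ))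
      = (Complex.I * (Real.pi : ℂ) * ((Real.sqrt (ap * aq) : ℝ) : ℂ) / 2) *
          (besselJ m (k * ap) : ℂ) *
          (hankelH1 (n - m) (k * norm2 (Op - Oq)) *
            Complex.exp (Complex.I * ((n : ℂ) - (m : ℂ)) * ((polarAngle (Op - Oq) : ℝ) : ℂ))) *
          (besselJ n (k * aq) : ℂ) := by
  have hsum : ∀ t : ℝ, (∫ s in (0:ℝ)..(2 * Real.pi),
      G k (circlePt Op ap t) (circlePt Oq aq s) * phiP Oq aq n (circlePt Oq aq s) * (aq : ℂ)) =
      Complex.I / 4 * (Real.pi * Complex.I)⁻¹ * (aq / (Real.sqrt (2 * Real.pi * aq) : ℝ)) *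
        (2 * Real.pi * besselJ n (k * aq) * hankelContour fun w =>
          Complex.exp ((k * norm2 (Op - Oq) : ℝ) * Complex.sinh w + (k * ap : ℝ) *
            Complex.sinh (w + (t - polarAngle (Op - Oq) : ℝ) * Complex.I)) *
          Complex.exp (-n * (w - polarAngle (Op - Oq) * Complex.I))) := by
    intro t
    rw [← integral_hankelContour_source (mul_pos hk hap) (mul_pos hk haq)
      (by rw [← mul_add]; exact mul_lt_mul_of_pos_left hsep hk) n (polarAngle (Op - Oq)) t,
      ← intervalIntegral.integral_const_mul]
    refine intervalIntegral.integral_congr fun s _ => ?_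
    simp only [G_circlePt_circlePt hk hap haq hsep, phiP_circlePt Oq haq]
    ring
  have hconj : ∀ t : ℝ, (starRingEnd ℂ) (phiP Op ap m (circlePt Op ap t)) =
      Complex.exp (-(m * (t * Complex.I))) / (Real.sqrt (2 * Real.pi * ap) : ℝ) := by
    intro t
    rw [phiP_circlePt Op hap, map_div₀, Complex.conj_ofReal, ← Complex.exp_conj]
    simp
  have htarget := integral_hankelContour_target (mul_pos hk hap)
    (mul_lt_mul_of_pos_left (by linarith : ap < norm2 (Op - Oq)) hk) m n (polarAngle (Op - Oq))
  have hsqrt : (ap / (Real.sqrt (2 * Real.pi * ap) : ℝ) * (aq / (Real.sqrt (2 * Real.pi * aq) : ℝ)) :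
      ℂ) * (2 * Real.pi) = (Real.sqrt (ap * aq) : ℝ) := by
    have h1 := Real.sqrt_pos.2 Real.two_pi_pos
    have h2 := Real.sqrt_pos.2 hap
    have h3 := Real.sqrt_pos.2 haq
    have h : ap / Real.sqrt (2 * Real.pi * ap) * (aq / Real.sqrt (2 * Real.pi * aq)) *
        (2 * Real.pi) = Real.sqrt (ap * aq) := by
      rw [Real.sqrt_mul Real.two_pi_pos.le, Real.sqrt_mul Real.two_pi_pos.le, Real.sqrt_mul hap.le]
      field_simp
      rw [Real.sq_sqrt Real.two_pi_pos.le, Real.sq_sqrt hap.le, Real.sq_sqrt haq.le]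
      ring
    exact_mod_cast h
  have hpi : (Real.pi : ℂ) ≠ 0 := by exact_mod_cast Real.pi_ne_zero
  simp only [hsum, hconj]
  calc _ = Complex.I / 4 * (Real.pi * Complex.I)⁻¹ * (2 * Real.pi * besselJ n (k * aq)) *
        (ap / (Real.sqrt (2 * Real.pi * ap) : ℝ) * (aq / (Real.sqrt (2 * Real.pi * aq) : ℝ))) *
        (2 * Real.pi * besselJ m (k * ap) *
          Complex.exp (Complex.I * (n - m) * polarAngle (Op - Oq)) *
          (Real.pi * Complex.I * hankelH1 (n - m) (k * norm2 (Op - Oq)))) := by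
        rw [← htarget, ← intervalIntegral.integral_const_mul]
        refine intervalIntegral.integral_congr fun t _ => ?_
        ring
    _ = _ := by
        rw [← hsqrt]
        field_simp
        ring
end
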